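/- Let p be an odd prime. Then N_{p−2} ≡ Σ_{m odd, 1 ≤ m ≤ p−2} H_m (mod p), i.e. the number of permutations of {1,…,p−2} with an even number of ascents is congruent modulo p to the sum of the harmonic numbers with odd index up to p−2. -/

import Mathlib

/-- The number of ascents of a permutation of `Fin n` (positions `i` with `σ i < σ (i+1)`). -/
def numAscents {n : ℕ} (σ : Equiv.Perm (Fin n)) : ℕ :=
  (Finset.univ.filter (fun i : Fin (n - 1) =>
    σ ⟨i.val, by have := i.isLt; omega⟩ < σ ⟨i.val + 1, by have := i.isLt; omega⟩)).card

/-- The number of permutations of `Fin n` with an even number of ascents. -/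
def evenAscentPerms (n : ℕ) : ℕ :=
  (Finset.univ.filter (fun σ : Equiv.Perm (Fin n) => Even (numAscents σ))).card

/-- The Eulerian number `E(n, m)`: permutations of `Fin n` with exactly `m` ascents. -/
def eulerian (n m : ℕ) : ℕ :=
  (Finset.univ.filter (fun σ : Equiv.Perm (Fin n) => numAscents σ = m)).card

/-- `x ≡ 0 (mod p^k)` for a rational `x`: either `x = 0` or the `p`-adic valuation
of `x` is at least `k`. -/
def PadicDvd (p k : ℕ) (x : ℚ) : Prop :=
  x = 0 ∨ (k : ℤ) ≤ padicValRat p x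

/-- The `m`-th harmonic number `H_m = 1 + 1/2 + ... + 1/m`. -/
def harmonic' (m : ℕ) : ℚ := ∑ k ∈ Finset.Icc 1 m, (1 : ℚ) / k

open Finset

theorem numAscents_le {n : ℕ} (σ : Equiv.Perm (Fin (n + 1))) : numAscents σ ≤ n := by
  refine (card_le_univ _).trans ?_
  simp

/-- The number of ascents of `σ` at positions before `i`. -/
def ascentsBefore {n : ℕ} (σ : Equiv.Perm (Fin (n + 1))) (i : Fin (n + 1)) : ℕ :=
  (univ.filter fun k : Fin n => k.castSucc < i ∧ σ k.castSucc < σ k.succ).card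

theorem ascentsBefore_zero {n : ℕ} (σ : Equiv.Perm (Fin (n + 1))) : ascentsBefore σ 0 = 0 := by
  simp [ascentsBefore]

theorem ascentsBefore_last {n : ℕ} (σ : Equiv.Perm (Fin (n + 1))) :
    ascentsBefore σ (Fin.last n) = numAscents σ := by
  simp only [ascentsBefore, Fin.castSucc_lt_last, true_and]
  rfl

theorem ascentsBefore_succ {n : ℕ} (σ : Equiv.Perm (Fin (n + 1))) (k : Fin n) :
    ascentsBefore σ k.succ =
      ascentsBefore σ k.castSucc + if σ k.castSucc < σ k.succ then 1 else 0 := by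
  have h : (univ.filter fun j : Fin n => j.castSucc < k.succ ∧ σ j.castSucc < σ j.succ) =
      (univ.filter fun j : Fin n => j.castSucc < k.castSucc ∧ σ j.castSucc < σ j.succ) ∪
        (if σ k.castSucc < σ k.succ then {k} else ∅) := by
    ext j
    have h1 : j.castSucc < k.succ ↔ j.castSucc < k.castSucc ∨ j = k := by
      simp only [Fin.lt_def, Fin.ext_iff, Fin.val_castSucc, Fin.val_succ]
      omega
    by_cases hjk : j = k
    · subst hjk
      split_ifs <;> simp_all
    · simp only [hjk, or_false] at h1
      split_ifs <;> simp only [mem_filter, mem_univ, true_and, mem_union, mem_singleton, hjk,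
        notMem_empty, or_false, h1]
  unfold ascentsBefore
  rw [h, card_union_of_disjoint]
  · split_ifs <;> simp
  · split_ifs <;> simp

/-- Functions into `Fin x` which become strictly increasing after adding a slowly growing
sequence `c` correspond to strictly increasing functions into `Fin (x + c (Fin.last n))`. -/
theorem card_filter_strictMono_add {n : ℕ} (x : ℕ) (c : Fin (n + 1) → ℕ) (h0 : c 0 = 0)
    (hmono : ∀ k : Fin n, c k.castSucc ≤ c k.succ)
    (hstep : ∀ k : Fin n, c k.succ ≤ c k.castSucc + 1) :
    (univ.filter fun g : Fin (n + 1) → Fin x => StrictMono fun i => (g i : ℕ) + c i).card =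
      (x + c (Fin.last n)).choose (n + 1) := by
  have hcm : Monotone c := Fin.monotone_iff_le_succ.2 hmono
  have hcard : Fintype.card (Fin (n + 1) ↪o Fin (x + c (Fin.last n))) =
      (x + c (Fin.last n)).choose (n + 1) := by
    rw [← Nat.card_eq_fintype_card, Nat.card_congr Set.powersetCard.ofFinEmbEquiv,
      Set.powersetCard.card, Nat.card_eq_fintype_card, Fintype.card_fin]
  rw [← hcard, ← card_univ]
  refine card_bij (fun g hg => OrderEmbedding.ofStrictMono
    (fun i => ⟨(g i : ℕ) + c i, Nat.add_lt_add_of_lt_of_le (g i).isLt (hcm (Fin.le_last i))⟩)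
    fun i j hij => (mem_filter.1 hg).2 hij) (fun _ _ => mem_univ _) ?_ ?_
  · intro g _ g' _ h
    funext i
    have : (g i : ℕ) + c i = g' i + c i := congrArg (fun f => ((f i : Fin _) : ℕ)) h
    exact Fin.ext (Nat.add_right_cancel this)
  · intro f _
    have hf : ∀ k : Fin n, (f k.castSucc : ℕ) < f k.succ :=
      fun k => f.strictMono k.castSucc_lt_succ
    have hle : ∀ i, c i ≤ f i := by
      intro i
      induction i using Fin.induction with
      | zero => simp [h0]
      | succ k ih => have := hf k; have := hstep k; omega
    have hm : Monotone fun i => (f i : ℕ) - c i := by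
      refine Fin.monotone_iff_le_succ.2 fun k => ?_
      have := hf k
      have := hstep k
      have := hle k.castSucc
      have := hle k.succ
      change (f k.castSucc : ℕ) - c k.castSucc ≤ (f k.succ : ℕ) - c k.succ
      omega
    have hlt : ∀ i, (f i : ℕ) - c i < x := by
      intro i
      refine (hm (Fin.le_last i)).trans_lt ?_
      have := (f (Fin.last n)).isLt
      have := hle (Fin.last n)
      change (f (Fin.last n) : ℕ) - c (Fin.last n) < x
      omega
    have hadd : ∀ i, (f i : ℕ) - c i + c i = f i := fun i => Nat.sub_add_cancel (hle i)
    refine ⟨fun i => ⟨(f i : ℕ) - c i, hlt i⟩, ?_, ?_⟩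
    · simp only [mem_filter, mem_univ, true_and, hadd]
      exact fun i j hij => f.strictMono hij
    · ext i
      exact hadd i

theorem eq_sort_iff_strictMono_add_ascentsBefore {n x : ℕ} (f : Fin (n + 1) → Fin x)
    (σ : Equiv.Perm (Fin (n + 1))) :
    σ = Tuple.sort f ↔ StrictMono fun i => (f (σ i) : ℕ) + ascentsBefore σ i := by
  have hlex : σ = Tuple.sort f ↔ StrictMono fun i => toLex (f (σ i), σ i) := by
    rw [Tuple.eq_sort_iff']
    rfl
  rw [hlex, Fin.strictMono_iff_lt_succ, Fin.strictMono_iff_lt_succ]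
  refine forall_congr' fun k => ?_
  simp only [Prod.Lex.toLex_lt_toLex, ascentsBefore_succ, Fin.lt_def, Fin.ext_iff]
  split_ifs <;> omega

/-- Worpitzky's identity. -/
theorem pow_eq_sum_choose_add_numAscents (n x : ℕ) :
    x ^ (n + 1) = ∑ σ : Equiv.Perm (Fin (n + 1)), (x + numAscents σ).choose (n + 1) := by
  have h : (univ : Finset (Fin (n + 1) → Fin x)).card = ∑ σ : Equiv.Perm (Fin (n + 1)),
      (univ.filter fun f : Fin (n + 1) → Fin x => Tuple.sort f = σ).card :=
    card_eq_sum_card_fiberwise fun _ _ => mem_univ _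
  rw [card_univ, Fintype.card_fun, Fintype.card_fin, Fintype.card_fin] at h
  rw [h]
  refine sum_congr rfl fun σ _ => ?_
  rw [← ascentsBefore_last, ← card_filter_strictMono_add x (ascentsBefore σ)
    (ascentsBefore_zero σ) (fun k => by rw [ascentsBefore_succ]; omega)
    (fun k => by rw [ascentsBefore_succ]; split_ifs <;> omega)]
  refine card_bij (fun f _ => f ∘ σ) ?_ ?_ ?_
  · intro f hf
    simp only [mem_filter, mem_univ, true_and] at hf ⊢
    exact (eq_sort_iff_strictMono_add_ascentsBefore f σ).1 hf.symm
  · intro f _ g _ hfg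
    exact σ.surjective.injective_comp_right hfg
  · intro g hg
    refine ⟨g ∘ σ.symm, ?_, by ext; simp⟩
    simp only [mem_filter, mem_univ, true_and] at hg ⊢
    refine ((eq_sort_iff_strictMono_add_ascentsBefore _ σ).2 ?_).symm
    simpa using hg

theorem sum_range_choose_add {a n : ℕ} (ha : a < n) (x : ℕ) :
    ∑ y ∈ range (x + 1), (y + a).choose n = (x + a + 1).choose (n + 1) := by
  induction x with
  | zero => simp [Nat.choose_eq_zero_of_lt, ha]
  | succ x ih =>
    rw [sum_range_succ, ih, show x + 1 + a + 1 = (x + a + 1) + 1 by ring,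
      Nat.choose_succ_succ' (x + a + 1) n, add_comm, show x + 1 + a = x + a + 1 by ring]

theorem sum_range_pow_eq_sum_choose (n x : ℕ) :
    ∑ y ∈ range (x + 1), y ^ (n + 1) =
      ∑ σ : Equiv.Perm (Fin (n + 1)), (x + numAscents σ + 1).choose (n + 2) := by
  simp_rw [pow_eq_sum_choose_add_numAscents]
  rw [sum_comm]
  exact sum_congr rfl fun σ _ => sum_range_choose_add (Nat.lt_succ_of_le (numAscents_le σ)) x

theorem natCast_choose_pred_prime {p M : ℕ} (hp : p.Prime) (hM : M < 2 * p - 1) :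
    ((M.choose (p - 1) : ℕ) : ZMod p) = if M = p - 1 then 1 else 0 := by
  have := hp.pos
  split_ifs with h
  · simp [h]
  · rcases lt_or_gt_of_ne h with h | h
    · simp [Nat.choose_eq_zero_of_lt h]
    · rw [ZMod.natCast_eq_zero_iff]
      exact hp.dvd_choose (by omega) (by omega) (by omega)

theorem natCast_evenAscentPerms {p : ℕ} (hp : p.Prime) (hodd : Odd p) :
    (evenAscentPerms (p - 2) : ZMod p) =
      ∑ m ∈ (Icc 1 (p - 2)).filter (fun m => Odd m), ∑ y ∈ Icc 1 m, (y : ZMod p) ^ (p - 2) := by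
  obtain ⟨n, rfl⟩ : ∃ n, p = n + 3 := by
    have := hp.two_le
    obtain ⟨k, rfl⟩ := hodd
    exact ⟨2 * k - 2, by omega⟩
  rw [show n + 3 - 2 = n + 1 by omega]
  have hinner : ∀ m ∈ (Icc 1 (n + 1)).filter (fun m => Odd m),
      ∑ y ∈ Icc 1 m, (y : ZMod (n + 3)) ^ (n + 1) =
        ∑ σ : Equiv.Perm (Fin (n + 1)), if m = n + 1 - numAscents σ then 1 else 0 := by
    intro m hm
    simp only [mem_filter, mem_Icc] at hm
    have h := congrArg (Nat.cast : ℕ → ZMod (n + 3)) (sum_range_pow_eq_sum_choose n m)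
    rw [Nat.range_eq_Icc_zero_sub_one _ (by omega), Nat.add_sub_cancel,
      ← add_sum_Ioc_eq_sum_Icc (Nat.zero_le m)] at h
    push_cast at h
    rw [zero_pow (by omega), zero_add] at h
    rw [show Icc 1 m = Ioc 0 m from rfl, h]
    refine sum_congr rfl fun σ _ => ?_
    have hσ := numAscents_le σ
    have := natCast_choose_pred_prime (M := m + numAscents σ + 1) hp (by omega)
    rw [show n + 3 - 1 = n + 2 by omega] at this
    rw [this]
    refine if_congr ?_ rfl rfl
    omega
  rw [sum_congr rfl hinner, sum_comm, evenAscentPerms, ← sum_boole]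
  refine sum_congr rfl fun σ _ => ?_
  rw [sum_ite_eq']
  refine if_congr ?_ rfl rfl
  have hσ := numAscents_le σ
  simp only [mem_filter, mem_Icc]
  have : Even n := by
    rw [Nat.odd_add] at hodd
    rw [← Nat.not_odd_iff_even]
    intro h
    exact absurd (hodd.1 h) (by decide)
  grind

theorem padicDvd_one_of_padicNorm_le {p : ℕ} [hp : Fact p.Prime] {x : ℚ}
    (h : padicNorm p x ≤ (p : ℚ) ^ (-1 : ℤ)) : PadicDvd p 1 x := by
  by_cases hx : x = 0
  · exact Or.inl hx
  · right
    rw [padicNorm.eq_zpow_of_nonzero hx,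
      zpow_le_zpow_iff_right₀ (by exact_mod_cast hp.out.one_lt)] at h
    push_cast
    omega

/-- Fermat's little theorem in the form `k ^ (p - 2) ≡ 1 / k`. -/
theorem padicNorm_pow_sub_one_div_le {p : ℕ} [hp : Fact p.Prime] {k : ℕ} (hk : ¬ p ∣ k) :
    padicNorm p ((k : ℚ) ^ (p - 2) - 1 / k) ≤ (p : ℚ) ^ (-1 : ℤ) := by
  have hk0 : (k : ℚ) ≠ 0 := by
    intro h
    exact hk (by simp [Nat.cast_eq_zero.1 h])
  have hpow : (k : ℚ) ^ (p - 2) - 1 / k = (((k : ℤ) ^ (p - 1) - 1 : ℤ) : ℚ) / (k : ℚ) := by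
    have := hp.out.two_le
    rw [show p - 1 = p - 2 + 1 by omega]
    rw [pow_succ]
    push_cast
    field_simp
  rw [hpow, padicNorm.div, (padicNorm.nat_eq_one_iff k).2 hk, div_one]
  refine (padicNorm.dvd_iff_norm_le (n := 1)).1 ?_
  rw [pow_one, ← ZMod.intCast_zmod_eq_zero_iff_dvd]
  push_cast
  rw [ZMod.pow_card_sub_one_eq_one, sub_self]
  rwa [Ne, ZMod.natCast_eq_zero_iff]

theorem even_ascent_perms_eq_sum_odd_index_harmonic
    (p : ℕ) (hp : p.Prime) (hodd : Odd p) :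
    PadicDvd p 1 ((evenAscentPerms (p - 2) : ℚ) -
      ∑ m ∈ (Finset.Icc 1 (p - 2)).filter (fun m => Odd m), harmonic' m) := by
  have : Fact p.Prime := ⟨hp⟩
  refine padicDvd_one_of_padicNorm_le ?_
  set S := (Icc 1 (p - 2)).filter (fun m => Odd m) with hS
  have hnonneg : (0 : ℚ) ≤ (p : ℚ) ^ (-1 : ℤ) := by positivity
  have hsplit : (evenAscentPerms (p - 2) : ℚ) - ∑ m ∈ S, harmonic' m =
      (((evenAscentPerms (p - 2) : ℤ) - ∑ m ∈ S, ∑ y ∈ Icc 1 m, (y : ℤ) ^ (p - 2) : ℤ) : ℚ) +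
        ∑ m ∈ S, ∑ y ∈ Icc 1 m, ((y : ℚ) ^ (p - 2) - 1 / y) := by
    simp only [harmonic', sum_sub_distrib]
    push_cast
    ring
  rw [hsplit]
  refine padicNorm.nonarchimedean.trans (max_le ?_ ?_)
  · refine (padicNorm.dvd_iff_norm_le (n := 1)).1 ?_
    rw [pow_one, ← ZMod.intCast_zmod_eq_zero_iff_dvd]
    push_cast
    rw [natCast_evenAscentPerms hp hodd, sub_self]
  · refine padicNorm.sum_le' (fun m hm => padicNorm.sum_le' (fun y hy => ?_) hnonneg) hnonneg
    simp only [hS, mem_filter, mem_Icc] at hm hy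
    exact padicNorm_pow_sub_one_div_le (Nat.not_dvd_of_pos_of_lt (by omega) (by omega))
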